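/- Convergence of spatial-temporal discretization without splitting: Let X, X_m, P_m, J_m form an approximation scheme, let A, A_m be a stable and consistent approximating family of operators, and suppose A generates a strongly continuous semigroup (T(t))_{t≥0} on X. Let r be a rational function with r(0) = 1, r'(0) = 1, bounded on the closed left half-plane ℂ₋ = {z ∈ ℂ : Re z ≤ 0}, with partial fraction decomposition r(z) = Σ_{i,j} C_{ij}(1 − z/λ_i)^{−j} (all Re λ_i > 0), and define r(hA_m) := Σ_{i,j} C_{ij} [ (λ_i/h) R(λ_i/h, A_m) ]^{j}. Suppose there exist M ≥ 1 and ω ∈ ℝ such that ‖[r(hA_m)]^{k}‖ ≤ M e^{kωh} for all h > 0 and all k, m ∈ ℕ. Then for every x ∈ X, lim_{m,n→∞} J_m [ r((t/n) A_m) ]^{n} P_m x = T(t)x, uniformly for t in compact intervals of [0,∞). -/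

import Mathlib

open Filter Topology

/-- `R` is the resolvent operator `R(lam, A) = (lam - A)⁻¹` of the (possibly
unbounded) linear operator `A`, given as a partially defined linear map. -/
structure IsResolvent {Y : Type*} [NormedAddCommGroup Y] [NormedSpace ℂ Y]
    (A : Y →ₗ.[ℂ] Y) (lam : ℂ) (R : Y →L[ℂ] Y) : Prop where
  mem : ∀ x : Y, R x ∈ A.domain
  eq_right : ∀ x : Y, lam • R x - A ⟨R x, mem x⟩ = x
  eq_left : ∀ y : A.domain, R (lam • (y : Y) - A y) = (y : Y)

/-- The operator `r(h A)` where the rational function `r` is given through its partial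
fraction decomposition `r(z) = Σ_{i,j} C i j • (1 - z/lam i)⁻ʲ` and the operator `A`
through its resolvent family `R`:  `r(h A) = Σ_{i,j} C i j • [(lam i/h) R(lam i/h, A)]ʲ`.
(For `h ≤ 0` it is defined to be the identity, corresponding to `r(0·A) = I`.) -/
noncomputable def ratOp {Y : Type*} [NormedAddCommGroup Y] [NormedSpace ℂ Y]
    (l : ℕ) (ν : Fin l → ℕ) (lam : Fin l → ℂ) (C : Fin l → ℕ → ℂ)
    (R : ℂ → Y →L[ℂ] Y) (h : ℝ) : Y →L[ℂ] Y :=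
  if h ≤ 0 then 1 else
    ∑ i, ∑ j ∈ Finset.Icc 1 (ν i), C i j • ((lam i / (h : ℂ)) • R (lam i / (h : ℂ))) ^ j

/-- The rational function `r(z) = Σ_{i,j} C i j (1 - z/lam i)⁻ʲ` given by a partial
fraction decomposition. -/
noncomputable def pfdFun (l : ℕ) (ν : Fin l → ℕ) (lam : Fin l → ℂ) (C : Fin l → ℕ → ℂ)
    (z : ℂ) : ℂ :=
  ∑ i, ∑ j ∈ Finset.Icc 1 (ν i), C i j * (1 - z / lam i) ^ (-(j : ℤ))

/-- `(T t)_{t ≥ 0}` is a strongly continuous semigroup of bounded linear operators. -/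
def IsC0Semigroup {Y : Type*} [NormedAddCommGroup Y] [NormedSpace ℂ Y]
    (T : ℝ → Y →L[ℂ] Y) : Prop :=
  T 0 = 1 ∧ (∀ s t : ℝ, 0 ≤ s → 0 ≤ t → T (s + t) = T s * T t) ∧
    ∀ x : Y, ContinuousOn (fun t : ℝ => T t x) (Set.Ici 0)

/-- The graph of the generator of a semigroup `T`: pairs `(x, y)` such that
`(T h x - x)/h → y` as `h → 0+`. -/
def generatorGraph {Y : Type*} [NormedAddCommGroup Y] [NormedSpace ℂ Y]
    (T : ℝ → Y →L[ℂ] Y) : Set (Y × Y) :=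
  {p | Tendsto (fun h : ℝ => ((h : ℂ))⁻¹ • (T h p.1 - p.1)) (𝓝[>] (0 : ℝ)) (𝓝 p.2)}

/-- The operator `A` generates the strongly continuous semigroup `T`. -/
def IsGenerator {Y : Type*} [NormedAddCommGroup Y] [NormedSpace ℂ Y]
    (A : Y →ₗ.[ℂ] Y) (T : ℝ → Y →L[ℂ] Y) : Prop :=
  IsC0Semigroup T ∧ (A.graph : Set (Y × Y)) = generatorGraph T

/-- Operators on a Banach space converging strongly to `0` along a countably generated filter
converge to `0` uniformly on compact sets. -/
theorem eventually_forall_mem_norm_le_of_isCompact {ι X Y : Type*} [NormedAddCommGroup X]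
    [NormedSpace ℂ X] [CompleteSpace X] [NormedAddCommGroup Y] [NormedSpace ℂ Y]
    {l : Filter ι} [l.IsCountablyGenerated] {G : ι → X →L[ℂ] Y}
    (hG : ∀ x, Tendsto (fun i => G i x) l (𝓝 0)) {S : Set X} (hS : IsCompact S)
    {ε : ℝ} (hε : 0 < ε) : ∀ᶠ i in l, ∀ x ∈ S, ‖G i x‖ ≤ ε := by
  by_contra hcon
  obtain ⟨u, hu, hfail⟩ := exists_seq_forall_of_frequently (not_eventually.mp hcon)
  push Not at hfail
  choose y hyS hy using hfail
  have hGu : ∀ x, Tendsto (fun k => G (u k) x) atTop (𝓝 0) := fun x => (hG x).comp hu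
  obtain ⟨C, hC⟩ := banach_steinhaus (g := fun k => G (u k)) fun x => by
    obtain ⟨c, hc⟩ := (hGu x).norm.bddAbove_range
    exact ⟨c, fun k => hc ⟨k, rfl⟩⟩
  obtain ⟨a, -, φ, hφ, hya⟩ := hS.tendsto_subseq hyS
  have hlim : Tendsto (fun k => C * ‖y (φ k) - a‖ + ‖G (u (φ k)) a‖) atTop (𝓝 0) := by
    have h1 : Tendsto (fun k => ‖y (φ k) - a‖) atTop (𝓝 0) :=
      tendsto_iff_norm_sub_tendsto_zero.mp hya
    simpa using (h1.const_mul C).add ((hGu a).comp hφ.tendsto_atTop).norm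
  obtain ⟨k, hk⟩ := (hlim.eventually_lt_const hε).exists
  have hle : ‖G (u (φ k)) (y (φ k))‖ ≤ C * ‖y (φ k) - a‖ + ‖G (u (φ k)) a‖ := by
    calc ‖G (u (φ k)) (y (φ k))‖ = ‖G (u (φ k)) (y (φ k) - a) + G (u (φ k)) a‖ := by
          rw [map_sub, sub_add_cancel]
      _ ≤ _ := (norm_add_le _ _).trans
          (add_le_add_left ((G (u (φ k))).le_of_opNorm_le (hC (φ k)) _) _)
  exact absurd (hy (φ k)) (not_lt.mpr (hle.trans hk.le))

/-- Strong convergence to `0` of an eventually bounded family may be checked on a dense set. -/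
theorem tendsto_norm_zero_of_dense {ι X : Type*} {Y : ι → Type*} [NormedAddCommGroup X]
    [NormedSpace ℂ X] [∀ i, NormedAddCommGroup (Y i)] [∀ i, NormedSpace ℂ (Y i)]
    {l : Filter ι} {G : ∀ i, X →L[ℂ] Y i} {C : ℝ} (hC : ∀ᶠ i in l, ‖G i‖ ≤ C)
    {D : Set X} (hD : Dense D) (hG : ∀ x ∈ D, Tendsto (fun i => ‖G i x‖) l (𝓝 0)) (x : X) :
    Tendsto (fun i => ‖G i x‖) l (𝓝 0) := by
  rw [tendsto_order]
  refine ⟨fun a ha => Eventually.of_forall fun i => ha.trans_le (norm_nonneg _), fun ε hε => ?_⟩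
  have hpos : 0 < |C| + 1 := by positivity
  obtain ⟨y, hyD, hy⟩ := Metric.dense_iff.mp hD x (ε / 2 / (|C| + 1)) (by positivity)
  rw [Metric.mem_ball, dist_eq_norm, norm_sub_rev] at hyD
  filter_upwards [hC, (hG y hy).eventually_lt_const (half_pos hε)] with i hi hiy
  have h1 : ‖G i (x - y)‖ ≤ (|C| + 1) * ‖x - y‖ :=
    (G i).le_of_opNorm_le (hi.trans ((le_abs_self C).trans (by linarith))) _
  have h2 : (|C| + 1) * ‖x - y‖ < ε / 2 := by
    rw [lt_div_iff₀ hpos] at hyD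
    linarith
  have h3 : ‖G i x‖ ≤ ‖G i (x - y)‖ + ‖G i y‖ := by
    simpa using norm_add_le (G i (x - y)) (G i y)
  linarith

theorem IsResolvent.smul_apply_sub {Y : Type*} [NormedAddCommGroup Y] [NormedSpace ℂ Y]
    {A : Y →ₗ.[ℂ] Y} {μ : ℂ} {R : Y →L[ℂ] Y} (hR : IsResolvent A μ R) (hμ : μ ≠ 0)
    (v : A.domain) : (μ • R) (v : Y) - v = μ⁻¹ • (μ • R) (A v) := by
  have h := hR.eq_left v
  rw [map_sub, map_smul] at h
  rw [smul_apply, smul_apply, inv_smul_smul₀ hμ]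
  nth_rewrite 2 [← h]
  abel

theorem pow_apply_sub_eq_smul_sum {Y : Type*} [NormedAddCommGroup Y] [NormedSpace ℂ Y]
    {Q : Y →L[ℂ] Y} {c : ℂ} {v w : Y} (h : Q v - v = c • Q w) (j : ℕ) :
    (Q ^ j) v - v = c • ∑ k ∈ Finset.Icc 1 j, (Q ^ k) w := by
  induction j with
  | zero => simp
  | succ j ih =>
    rw [Finset.sum_Icc_succ_top (by omega), smul_add, ← ih, pow_succ]
    simp only [mul_apply_eq_comp]
    rw [← map_smul, ← h, map_sub]
    abel

theorem norm_pow_apply_sub_le {Y : Type*} [NormedAddCommGroup Y] [NormedSpace ℂ Y]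
    {Q : Y →L[ℂ] Y} {C : ℝ} (hQ : ‖Q‖ ≤ C) (v : Y) (k : ℕ) :
    ‖(Q ^ k) v - v‖ ≤ (∑ j ∈ Finset.range k, C ^ j) * ‖Q v - v‖ := by
  induction k with
  | zero => simp
  | succ k ih =>
    have h1 : (Q ^ (k + 1)) v - v = (Q ^ k) (Q v - v) + ((Q ^ k) v - v) := by
      rw [pow_succ, mul_apply_eq_comp, map_sub]
      abel
    have h2 : ‖(Q ^ k) (Q v - v)‖ ≤ C ^ k * ‖Q v - v‖ := by
      clear ih h1
      generalize Q v - v = w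
      induction k with
      | zero => simp
      | succ k ih =>
        rw [pow_succ', mul_apply_eq_comp, pow_succ', mul_assoc]
        exact Q.le_of_opNorm_le_of_le hQ ih
    rw [h1, Finset.sum_range_succ, add_mul, add_comm]
    exact (norm_add_le _ _).trans (by linarith)

theorem pfdFun_zero (l : ℕ) (ν : Fin l → ℕ) (lam : Fin l → ℂ) (C : Fin l → ℕ → ℂ) :
    pfdFun l ν lam C 0 = ∑ i, ∑ j ∈ Finset.Icc 1 (ν i), C i j := by
  simp [pfdFun]

theorem hasDerivAt_pfdFun_zero (l : ℕ) (ν : Fin l → ℕ) (lam : Fin l → ℂ)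
    (C : Fin l → ℕ → ℂ) :
    HasDerivAt (pfdFun l ν lam C)
      (∑ i, ∑ j ∈ Finset.Icc 1 (ν i), C i j / lam i * (j : ℂ)) 0 := by
  unfold pfdFun
  refine HasDerivAt.fun_sum fun i _ => HasDerivAt.fun_sum fun j _ => ?_
  have h1 : HasDerivAt (fun z : ℂ => 1 - z / lam i) (-(1 / lam i)) 0 :=
    ((hasDerivAt_id (0 : ℂ)).div_const (lam i)).const_sub 1
  have h2 : HasDerivAt (fun w : ℂ => w ^ (-(j : ℤ))) (-(j : ℂ)) (1 - 0 / lam i) := by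
    have := hasDerivAt_zpow (-(j : ℤ)) (1 - 0 / lam i) (Or.inl (by simp))
    simpa using this
  refine ((h2.comp (0 : ℂ) h1).const_mul (C i j)).congr_deriv ?_
  ring

/-- The operator `s(h A)`, where `s(z) = (r(z) - 1) / z` is the difference quotient of the
rational function `r`. -/
noncomputable def ratQuot {Y : Type*} [NormedAddCommGroup Y] [NormedSpace ℂ Y]
    (l : ℕ) (ν : Fin l → ℕ) (lam : Fin l → ℂ) (C : Fin l → ℕ → ℂ)
    (R : ℂ → Y →L[ℂ] Y) (h : ℝ) : Y →L[ℂ] Y :=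
  ∑ i, ∑ j ∈ Finset.Icc 1 (ν i), (C i j / lam i) •
    ∑ k ∈ Finset.Icc 1 j, ((lam i / (h : ℂ)) • R (lam i / (h : ℂ))) ^ k

section

variable {Y : Type*} [NormedAddCommGroup Y] [NormedSpace ℂ Y] {A : Y →ₗ.[ℂ] Y}
  {R : ℂ → Y →L[ℂ] Y} {M : ℝ}

theorem norm_smul_resolvent_le
    (hR : ∀ μ : ℂ, 0 < μ.re → IsResolvent A μ (R μ) ∧ μ.re * ‖R μ‖ ≤ M)
    {μ : ℂ} (hμ : 0 < μ.re) {h : ℝ} (hh : 0 < h) :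
    ‖(μ / (h : ℂ)) • R (μ / (h : ℂ))‖ ≤ ‖μ‖ / μ.re * M := by
  have hre : (μ / (h : ℂ)).re = μ.re / h := Complex.div_ofReal_re μ h
  have hb := (hR (μ / h) (by rw [hre]; positivity)).2
  rw [hre] at hb
  rw [norm_smul, norm_div, Complex.norm_real, Real.norm_of_nonneg hh.le]
  calc ‖μ‖ / h * ‖R (μ / h)‖ = ‖μ‖ / μ.re * (μ.re / h * ‖R (μ / h)‖) := by field_simp
    _ ≤ _ := by gcongr

theorem ratOp_apply_sub
    (hR : ∀ μ : ℂ, 0 < μ.re → IsResolvent A μ (R μ) ∧ μ.re * ‖R μ‖ ≤ M)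
    {l : ℕ} {ν : Fin l → ℕ} {lam : Fin l → ℂ} {C : Fin l → ℕ → ℂ}
    (hlam : ∀ i, 0 < (lam i).re) (hr0 : pfdFun l ν lam C 0 = 1) {h : ℝ} (hh : 0 < h)
    (v : A.domain) :
    ratOp l ν lam C R h (v : Y) - v = (h : ℂ) • ratQuot l ν lam C R h (A v) := by
  have hh0 : (h : ℂ) ≠ 0 := by exact_mod_cast hh.ne'
  rw [pfdFun_zero] at hr0
  have hv : (v : Y) = ∑ i, ∑ j ∈ Finset.Icc 1 (ν i), C i j • (v : Y) := by
    simp_rw [← Finset.sum_smul]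
    rw [hr0, one_smul]
  rw [ratOp, if_neg (not_le.mpr hh), ratQuot]
  conv_lhs => rw [hv]
  simp only [sum_apply, smul_apply]
  rw [← hv]
  nth_rewrite 2 [hv]
  simp_rw [← Finset.sum_sub_distrib, Finset.smul_sum (r := (h : ℂ)), ← smul_sub]
  refine Finset.sum_congr rfl fun i _ => Finset.sum_congr rfl fun j _ => ?_
  have hl0 : lam i ≠ 0 := fun h0 => by simpa [h0] using hlam i
  have hres := (hR (lam i / h) (by rw [Complex.div_ofReal_re]; exact div_pos (hlam i) hh)).1
  rw [pow_apply_sub_eq_smul_sum (hres.smul_apply_sub (div_ne_zero hl0 hh0) v) j, smul_smul,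
    smul_smul]
  congr 1
  field_simp

theorem exists_norm_ratQuot_le {l : ℕ} (ν : Fin l → ℕ) {lam : Fin l → ℂ}
    (C : Fin l → ℕ → ℂ) (hlam : ∀ i, 0 < (lam i).re) (M : ℝ) :
    ∃ B : ℝ, 0 ≤ B ∧ ∀ {Y : Type*} [NormedAddCommGroup Y] [NormedSpace ℂ Y]
      {A : Y →ₗ.[ℂ] Y} {R : ℂ → Y →L[ℂ] Y},
      (∀ μ : ℂ, 0 < μ.re → IsResolvent A μ (R μ) ∧ μ.re * ‖R μ‖ ≤ M) →
      ∀ (h : ℝ), 0 < h → ∀ v, ‖ratQuot l ν lam C R h v‖ ≤ B * ‖v‖ := by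
  refine ⟨|∑ i, ∑ j ∈ Finset.Icc 1 (ν i), ‖C i j / lam i‖ *
    ∑ k ∈ Finset.Icc 1 j, (‖lam i‖ / (lam i).re * M) ^ k|, abs_nonneg _, ?_⟩
  intro Y _ _ A R hR h hh v
  refine ContinuousLinearMap.le_of_opNorm_le _ ((?_ : _ ≤ _).trans (le_abs_self _)) v
  refine norm_sum_le_of_le _ fun i _ => norm_sum_le_of_le _ fun j _ => ?_
  rw [norm_smul]
  refine mul_le_mul_of_nonneg_left (norm_sum_le_of_le _ fun k hk => ?_) (norm_nonneg _)
  exact (norm_pow_le' _ (Finset.mem_Icc.mp hk).1).trans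
    (pow_le_pow_left₀ (norm_nonneg _) (norm_smul_resolvent_le hR (hlam i) hh) k)

end

section

variable {X : Type*} [NormedAddCommGroup X] [NormedSpace ℂ X]
  {Xm : ℕ → Type*} [∀ m, NormedAddCommGroup (Xm m)] [∀ m, NormedSpace ℂ (Xm m)]
  {P : ∀ m, X →L[ℂ] Xm m} {J : ∀ m, Xm m →L[ℂ] X} {K : ℝ}
  {A : X →ₗ.[ℂ] X} {Am : ∀ m, Xm m →ₗ.[ℂ] Xm m}
  {RAm : ∀ m, ℂ → Xm m →L[ℂ] Xm m} {M : ℝ}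

theorem norm_le_mul_norm_of_leftInverse (hPJ : ∀ m (y : Xm m), P m (J m y) = y)
    (hPnorm : ∀ m, ‖P m‖ ≤ K) (m : ℕ) (y : Xm m) : ‖y‖ ≤ K * ‖J m y‖ := by
  conv_lhs => rw [← hPJ m y]
  exact (P m).le_of_opNorm_le (hPnorm m) _

/-- The operators `(μ / h) R(μ / h, A m)` converge strongly to the identity as `h → 0+`,
uniformly in the limit `m → ∞`. -/
theorem tendsto_norm_smul_resolvent_sub
    (hPJ : ∀ m (y : Xm m), P m (J m y) = y) (hPnorm : ∀ m, ‖P m‖ ≤ K)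
    (hAdense : Dense (A.domain : Set X))
    (hRAm : ∀ m, ∀ lam : ℂ, 0 < lam.re →
      IsResolvent (Am m) lam (RAm m lam) ∧ lam.re * ‖RAm m lam‖ ≤ M)
    (hPdom : ∀ m, ∀ x ∈ A.domain, P m x ∈ (Am m).domain)
    (hcons : ∀ x : A.domain,
      Tendsto (fun m => J m ((Am m) ⟨P m (x : X), hPdom m x x.2⟩)) atTop (𝓝 (A x)))
    {μ : ℂ} (hμ : 0 < μ.re) (z : X) :
    Tendsto (fun p : ℕ × ℝ =>
      ‖((μ / (p.2 : ℂ)) • RAm p.1 (μ / (p.2 : ℂ))) (P p.1 z) - P p.1 z‖)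
      (atTop ×ˢ 𝓝[>] (0 : ℝ)) (𝓝 0) := by
  have hpos : ∀ᶠ p : ℕ × ℝ in atTop ×ˢ 𝓝[>] (0 : ℝ), 0 < p.2 :=
    tendsto_snd.eventually self_mem_nhdsWithin
  have hμ0 : μ ≠ 0 := fun h0 => by simp [h0] at hμ
  refine tendsto_norm_zero_of_dense (Y := fun p : ℕ × ℝ => Xm p.1)
    (G := fun p : ℕ × ℝ =>
      ((μ / (p.2 : ℂ)) • RAm p.1 (μ / (p.2 : ℂ))).comp (P p.1) - P p.1)
    (C := ‖μ‖ / μ.re * M * K + K) ?_ hAdense ?_ z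
  · filter_upwards [hpos] with p hp
    have hQ := norm_smul_resolvent_le (hRAm p.1) hμ hp
    refine (norm_sub_le _ _).trans (add_le_add ?_ (hPnorm _))
    refine (ContinuousLinearMap.opNorm_comp_le _ _).trans ?_
    exact mul_le_mul hQ (hPnorm _) (norm_nonneg _) ((norm_nonneg _).trans hQ)
  · intro x hx
    have hlim : Tendsto (fun p : ℕ × ℝ => |p.2| / ‖μ‖ * (‖μ‖ / μ.re * M *
        (K * ‖J p.1 ((Am p.1) ⟨P p.1 x, hPdom p.1 x hx⟩)‖))) (atTop ×ˢ 𝓝[>] (0 : ℝ))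
        (𝓝 (|0| / ‖μ‖ * (‖μ‖ / μ.re * M * (K * ‖A ⟨x, hx⟩‖)))) := by
      have h2 : Tendsto (fun p : ℕ × ℝ => p.2) (atTop ×ˢ 𝓝[>] (0 : ℝ)) (𝓝 0) :=
        (tendsto_nhdsWithin_of_tendsto_nhds tendsto_id).comp tendsto_snd
      exact (h2.abs.div_const _).mul
        ((((hcons ⟨x, hx⟩).comp tendsto_fst).norm.const_mul K).const_mul _)
    rw [abs_zero, zero_div, zero_mul] at hlim
    refine squeeze_zero' (Eventually.of_forall fun _ => norm_nonneg _) ?_ hlim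
    filter_upwards [hpos] with p hp
    have hp0 : (p.2 : ℂ) ≠ 0 := by exact_mod_cast hp.ne'
    have hQ := norm_smul_resolvent_le (hRAm p.1) hμ hp
    have hres := (hRAm p.1 (μ / (p.2 : ℂ))
      (by rw [Complex.div_ofReal_re]; exact div_pos hμ hp)).1
    have heq := hres.smul_apply_sub (div_ne_zero hμ0 hp0) ⟨P p.1 x, hPdom p.1 x hx⟩
    change ‖((μ / (p.2 : ℂ)) • RAm p.1 (μ / (p.2 : ℂ))) (P p.1 x) - P p.1 x‖ ≤ _
    rw [heq, norm_smul, inv_div, norm_div, Complex.norm_real, Real.norm_eq_abs]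
    gcongr
    exact ContinuousLinearMap.le_of_opNorm_le_of_le _ hQ
      (norm_le_mul_norm_of_leftInverse hPJ hPnorm _ _)

theorem tendsto_norm_ratQuot_sub
    (hPJ : ∀ m (y : Xm m), P m (J m y) = y) (hPnorm : ∀ m, ‖P m‖ ≤ K)
    (hAdense : Dense (A.domain : Set X))
    (hRAm : ∀ m, ∀ lam : ℂ, 0 < lam.re →
      IsResolvent (Am m) lam (RAm m lam) ∧ lam.re * ‖RAm m lam‖ ≤ M)
    (hPdom : ∀ m, ∀ x ∈ A.domain, P m x ∈ (Am m).domain)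
    (hcons : ∀ x : A.domain,
      Tendsto (fun m => J m ((Am m) ⟨P m (x : X), hPdom m x x.2⟩)) atTop (𝓝 (A x)))
    {l : ℕ} {ν : Fin l → ℕ} {lam : Fin l → ℂ} {C : Fin l → ℕ → ℂ}
    (hlam : ∀ i, 0 < (lam i).re) (hr1 : HasDerivAt (pfdFun l ν lam C) 1 0) (z : X) :
    Tendsto (fun p : ℕ × ℝ => ‖ratQuot l ν lam C (RAm p.1) p.2 (P p.1 z) - P p.1 z‖)
      (atTop ×ˢ 𝓝[>] (0 : ℝ)) (𝓝 0) := by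
  have hpos : ∀ᶠ p : ℕ × ℝ in atTop ×ˢ 𝓝[>] (0 : ℝ), 0 < p.2 :=
    tendsto_snd.eventually self_mem_nhdsWithin
  have hsum : ∑ i, ∑ j ∈ Finset.Icc 1 (ν i), C i j / lam i * (j : ℂ) = 1 :=
    (hasDerivAt_pfdFun_zero l ν lam C).unique hr1
  have hlim : Tendsto (fun p : ℕ × ℝ => ∑ i, ∑ j ∈ Finset.Icc 1 (ν i), ‖C i j / lam i‖ *
      ∑ k ∈ Finset.Icc 1 j, (∑ q ∈ Finset.range k, (‖lam i‖ / (lam i).re * M) ^ q) *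
        ‖((lam i / (p.2 : ℂ)) • RAm p.1 (lam i / (p.2 : ℂ))) (P p.1 z) - P p.1 z‖)
      (atTop ×ˢ 𝓝[>] (0 : ℝ)) (𝓝 (∑ i, ∑ j ∈ Finset.Icc 1 (ν i), ‖C i j / lam i‖ *
      ∑ k ∈ Finset.Icc 1 j, (∑ q ∈ Finset.range k, (‖lam i‖ / (lam i).re * M) ^ q) * 0)) :=
    tendsto_finsetSum _ fun i _ => tendsto_finsetSum _ fun j _ =>
      (tendsto_finsetSum _ fun k _ => (tendsto_norm_smul_resolvent_sub hPJ hPnorm hAdense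
        hRAm hPdom hcons (hlam i) z).const_mul _).const_mul _
  simp only [mul_zero, Finset.sum_const_zero] at hlim
  refine squeeze_zero' (Eventually.of_forall fun _ => norm_nonneg _) ?_ hlim
  filter_upwards [hpos] with p hp
  have hz : P p.1 z = ∑ i, ∑ j ∈ Finset.Icc 1 (ν i), (C i j / lam i) •
      ∑ k ∈ Finset.Icc 1 j, P p.1 z := by
    simp_rw [Finset.sum_const, Nat.card_Icc, Nat.add_sub_cancel, ← Nat.cast_smul_eq_nsmul ℂ,
      smul_smul, ← Finset.sum_smul]
    rw [hsum, one_smul]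
  have heq : ratQuot l ν lam C (RAm p.1) p.2 (P p.1 z) - P p.1 z =
      ∑ i, ∑ j ∈ Finset.Icc 1 (ν i), (C i j / lam i) • ∑ k ∈ Finset.Icc 1 j,
        ((((lam i / (p.2 : ℂ)) • RAm p.1 (lam i / (p.2 : ℂ))) ^ k) (P p.1 z) - P p.1 z) := by
    conv_lhs =>
      arg 2
      rw [hz]
    simp only [ratQuot, sum_apply, smul_apply, ← Finset.sum_sub_distrib,
      ← smul_sub]
  rw [heq]
  refine norm_sum_le_of_le _ fun i _ => norm_sum_le_of_le _ fun j _ => ?_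
  rw [norm_smul]
  refine mul_le_mul_of_nonneg_left (norm_sum_le_of_le _ fun k _ => ?_) (norm_nonneg _)
  exact norm_pow_apply_sub_le (norm_smul_resolvent_le (hRAm p.1) (hlam i) hp) _ k

/-- Consistency of the one-step approximation `r(h A m)`. -/
theorem tendsto_norm_ratOp_sub
    (hPJ : ∀ m (y : Xm m), P m (J m y) = y) (hPnorm : ∀ m, ‖P m‖ ≤ K)
    (hJP : ∀ x : X, Tendsto (fun m => J m (P m x)) atTop (𝓝 x))
    (hAdense : Dense (A.domain : Set X))
    (hRAm : ∀ m, ∀ lam : ℂ, 0 < lam.re →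
      IsResolvent (Am m) lam (RAm m lam) ∧ lam.re * ‖RAm m lam‖ ≤ M)
    (hPdom : ∀ m, ∀ x ∈ A.domain, P m x ∈ (Am m).domain)
    (hcons : ∀ x : A.domain,
      Tendsto (fun m => J m ((Am m) ⟨P m (x : X), hPdom m x x.2⟩)) atTop (𝓝 (A x)))
    {l : ℕ} {ν : Fin l → ℕ} {lam : Fin l → ℂ} {C : Fin l → ℕ → ℂ}
    (hlam : ∀ i, 0 < (lam i).re) (hr0 : pfdFun l ν lam C 0 = 1)
    (hr1 : HasDerivAt (pfdFun l ν lam C) 1 0) (y : A.domain) :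
    Tendsto (fun p : ℕ × ℝ => ‖(p.2 : ℂ)⁻¹ •
        (ratOp l ν lam C (RAm p.1) p.2 (P p.1 y) - P p.1 y) - P p.1 (A y)‖)
      (atTop ×ˢ 𝓝[>] (0 : ℝ)) (𝓝 0) := by
  have hpos : ∀ᶠ p : ℕ × ℝ in atTop ×ˢ 𝓝[>] (0 : ℝ), 0 < p.2 :=
    tendsto_snd.eventually self_mem_nhdsWithin
  obtain ⟨B, hB0, hB⟩ := exists_norm_ratQuot_le ν C hlam M
  have hE : Tendsto (fun m => B * (K * ‖J m ((Am m) ⟨P m (y : X), hPdom m y y.2⟩) -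
      J m (P m (A y))‖)) atTop (𝓝 0) := by
    simpa using (((hcons y).sub (hJP (A y))).norm.const_mul K).const_mul B
  have hlim := (hE.comp tendsto_fst).add
    (tendsto_norm_ratQuot_sub hPJ hPnorm hAdense hRAm hPdom hcons hlam hr1 (A y))
  rw [add_zero] at hlim
  refine squeeze_zero' (Eventually.of_forall fun _ => norm_nonneg _) ?_ hlim
  filter_upwards [hpos] with p hp
  have hp0 : (p.2 : ℂ) ≠ 0 := by exact_mod_cast hp.ne'
  have heq := ratOp_apply_sub (hRAm p.1) hlam hr0 hp ⟨P p.1 y, hPdom p.1 y y.2⟩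
  dsimp only at heq
  rw [heq, inv_smul_smul₀ hp0]
  set S := ratQuot l ν lam C (RAm p.1) p.2
  set w := (Am p.1) ⟨P p.1 (y : X), hPdom p.1 y y.2⟩
  have hsplit : S w - P p.1 (A y) = S (w - P p.1 (A y)) + (S (P p.1 (A y)) - P p.1 (A y)) := by
    rw [map_sub]
    abel
  rw [hsplit]
  refine (norm_add_le _ _).trans (add_le_add_left ?_ _)
  refine (hB (hRAm p.1) p.2 hp _).trans (mul_le_mul_of_nonneg_left ?_ hB0)
  rw [← map_sub]
  exact norm_le_mul_norm_of_leftInverse hPJ hPnorm _ _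

end

/-- Telescoping estimate behind the Lax equivalence theorem. -/
theorem norm_pow_apply_sub_le_of_step {X Y : Type*} [NormedAddCommGroup X] [NormedSpace ℂ X]
    [NormedAddCommGroup Y] [NormedSpace ℂ Y] (F : Y →L[ℂ] Y) (P : X →L[ℂ] Y) {n : ℕ}
    {B δ : ℝ} (hF : ∀ k < n, ‖F ^ k‖ ≤ B) (u : ℕ → X)
    (hu : ∀ k < n, ‖F (P (u k)) - P (u (k + 1))‖ ≤ δ) :
    ‖(F ^ n) (P (u 0)) - P (u n)‖ ≤ n * (B * δ) := by
  have htel := Finset.sum_range_sub' (fun k => (F ^ (n - k)) (P (u k))) n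
  simp only [Nat.sub_zero, Nat.sub_self, pow_zero, one_apply_eq_self] at htel
  rw [← htel]
  refine (norm_sum_le_of_le _ (n := fun _ => B * δ) fun k hk => ?_).trans (by simp)
  have hk' := Finset.mem_range.mp hk
  have h1 : n - k = n - (k + 1) + 1 := by omega
  rw [h1, pow_succ, mul_apply_eq_comp, ← map_sub]
  exact ContinuousLinearMap.le_of_opNorm_le_of_le _ (hF _ (by omega)) (hu k hk')

section

variable {X : Type*} [NormedAddCommGroup X] [NormedSpace ℂ X] {A : X →ₗ.[ℂ] X}
  {T : ℝ → X →L[ℂ] X}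

theorem IsGenerator.tendsto_apply (hT : IsGenerator A T) (y : A.domain) :
    Tendsto (fun h : ℝ => ((h : ℂ))⁻¹ • (T h y - y)) (𝓝[>] (0 : ℝ)) (𝓝 (A y)) := by
  have h : ((y : X), A y) ∈ (A.graph : Set (X × X)) := A.mem_graph y
  rw [hT.2] at h
  exact h

theorem IsGenerator.apply_resolvent (hT : IsGenerator A T) {μ : ℂ} {R : X →L[ℂ] X}
    (hR : IsResolvent A μ R) {s : ℝ} (hs : 0 ≤ s) (x : X) : T s (R x) = R (T s x) := by
  have hgr : (T s (R x), T s (A ⟨R x, hR.mem x⟩)) ∈ (A.graph : Set (X × X)) := by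
    rw [hT.2]
    have h1 := ((T s).continuous.tendsto _).comp (hT.tendsto_apply ⟨R x, hR.mem x⟩)
    refine h1.congr' ?_
    filter_upwards [self_mem_nhdsWithin] with h hh
    have hh' : 0 ≤ h := le_of_lt hh
    have hcomm : T s * T h = T h * T s := by
      rw [← hT.1.2.1 s h hs hh', ← hT.1.2.1 h s hh' hs, add_comm]
    simp only [Function.comp_apply, map_smul, map_sub]
    rw [← mul_apply_eq_comp (T s), hcomm, mul_apply_eq_comp]
  obtain ⟨u, hu1, hu2⟩ := LinearPMap.mem_graph_iff _ |>.mp hgr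
  dsimp only at hu1 hu2
  have h2 := hR.eq_left u
  rw [hu1, hu2, ← map_smul, ← map_sub, hR.eq_right x] at h2
  exact h2.symm

theorem IsC0Semigroup.exists_norm_le [CompleteSpace X] (hT : IsC0Semigroup T) (t₀ : ℝ) :
    ∃ B : ℝ, ∀ t ∈ Set.Icc 0 t₀, ‖T t‖ ≤ B := by
  obtain ⟨B, hB⟩ := banach_steinhaus (g := fun t : Set.Icc 0 t₀ => T t) fun x => by
    obtain ⟨c, hc⟩ := (isCompact_Icc (a := 0) (b := t₀)).exists_bound_of_continuousOn
      ((hT.2.2 x).mono Set.Icc_subset_Ici_self)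
    exact ⟨c, fun t => hc t t.2⟩
  exact ⟨B, fun t ht => hB ⟨t, ht⟩⟩

end

/-- The local error of the one-step approximation `r(h A m)` is `o(h)` along regular orbits of the
semigroup, uniformly on compact time intervals. -/
theorem exists_norm_ratOp_sub_semigroup_le
    {X : Type*} [NormedAddCommGroup X] [NormedSpace ℂ X] [CompleteSpace X]
    {Xm : ℕ → Type*} [∀ m, NormedAddCommGroup (Xm m)] [∀ m, NormedSpace ℂ (Xm m)]
    {P : ∀ m, X →L[ℂ] Xm m} {J : ∀ m, Xm m →L[ℂ] X} {K : ℝ}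
    {A : X →ₗ.[ℂ] X} {Am : ∀ m, Xm m →ₗ.[ℂ] Xm m}
    {RAm : ∀ m, ℂ → Xm m →L[ℂ] Xm m} {M : ℝ}
    (hK : 0 < K) (hPJ : ∀ m (y : Xm m), P m (J m y) = y)
    (hJnorm : ∀ m, ‖J m‖ ≤ K) (hPnorm : ∀ m, ‖P m‖ ≤ K)
    (hJP : ∀ x : X, Tendsto (fun m => J m (P m x)) atTop (𝓝 x))
    (hAdense : Dense (A.domain : Set X))
    (hRAm : ∀ m, ∀ lam : ℂ, 0 < lam.re →
      IsResolvent (Am m) lam (RAm m lam) ∧ lam.re * ‖RAm m lam‖ ≤ M)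
    (hPdom : ∀ m, ∀ x ∈ A.domain, P m x ∈ (Am m).domain)
    (hcons : ∀ x : A.domain,
      Tendsto (fun m => J m ((Am m) ⟨P m (x : X), hPdom m x x.2⟩)) atTop (𝓝 (A x)))
    {l : ℕ} {ν : Fin l → ℕ} {lam : Fin l → ℂ} {C : Fin l → ℕ → ℂ}
    (hlam : ∀ i, 0 < (lam i).re) (hr0 : pfdFun l ν lam C 0 = 1)
    (hr1 : HasDerivAt (pfdFun l ν lam C) 1 0) {T : ℝ → X →L[ℂ] X} (hT : IsGenerator A T)
    {μ : ℂ} {R : X →L[ℂ] X} (hR : IsResolvent A μ R) (x : X) (t₀ : ℝ) {ε : ℝ} (hε : 0 < ε) :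
    ∃ N : ℕ, ∃ δ > (0 : ℝ), ∀ m ≥ N, ∀ h : ℝ, 0 < h → h < δ → ∀ s ∈ Set.Icc 0 t₀,
      ‖ratOp l ν lam C (RAm m) h (P m (T s (R x))) - P m (T (s + h) (R x))‖ ≤ ε * h := by
  let G : ℕ × ℝ → X →L[ℂ] X := fun p => (J p.1).comp ((((p.2 : ℂ)⁻¹ •
    ((ratOp l ν lam C (RAm p.1) p.2).comp (P p.1) - (P p.1).comp (T p.2))).comp R))
  have hG : ∀ z, Tendsto (fun p => G p z) (atTop ×ˢ 𝓝[>] (0 : ℝ)) (𝓝 0) := by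
    intro z
    set y : A.domain := ⟨R z, hR.mem z⟩
    have hsemi : Tendsto (fun p : ℕ × ℝ => ‖A y - (p.2 : ℂ)⁻¹ • (T p.2 y - y)‖)
        (atTop ×ˢ 𝓝[>] (0 : ℝ)) (𝓝 0) := by
      have h1 := ((hT.tendsto_apply y).const_sub (A y)).norm
      rw [sub_self, norm_zero] at h1
      exact h1.comp tendsto_snd
    have hlim := ((tendsto_norm_ratOp_sub hPJ hPnorm hJP hAdense hRAm hPdom hcons hlam hr0 hr1
      y).add (hsemi.const_mul K)).const_mul K
    simp only [mul_zero, add_zero] at hlim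
    refine squeeze_zero_norm (fun p => ?_) hlim
    refine ContinuousLinearMap.le_of_opNorm_le_of_le (J p.1) (hJnorm p.1) ?_
    have hsplit : (((p.2 : ℂ)⁻¹ • ((ratOp l ν lam C (RAm p.1) p.2).comp (P p.1) -
        (P p.1).comp (T p.2))).comp R) z = ((p.2 : ℂ)⁻¹ •
        (ratOp l ν lam C (RAm p.1) p.2 (P p.1 y) - P p.1 y) - P p.1 (A y)) +
        P p.1 (A y - (p.2 : ℂ)⁻¹ • (T p.2 y - y)) := by
      simp only [ContinuousLinearMap.comp_apply, smul_apply, sub_apply, map_sub, map_smul,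
        smul_sub, y]
      abel
    refine (congrArg norm hsplit).trans_le ?_
    exact (norm_add_le _ _).trans (add_le_add_right ((P p.1).le_of_opNorm_le (hPnorm _) _) _)
  have hS : IsCompact ((fun t => T t x) '' Set.Icc 0 t₀) :=
    isCompact_Icc.image_of_continuousOn ((hT.1.2.2 x).mono Set.Icc_subset_Ici_self)
  have hev := eventually_forall_mem_norm_le_of_isCompact hG hS (div_pos hε hK)
  obtain ⟨⟨N, δ⟩, ⟨-, hδ⟩, hN⟩ := (atTop_basis.prod (nhdsGT_basis (0 : ℝ))).eventually_iff.mp hev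
  refine ⟨N, δ, hδ, fun m hm h hh hhδ s hs => ?_⟩
  have hb := hN (x := (m, h)) ⟨hm, hh, hhδ⟩ _ ⟨s, hs, rfl⟩
  have hh0 : (h : ℂ) ≠ 0 := by exact_mod_cast hh.ne'
  set v := ratOp l ν lam C (RAm m) h (P m (T s (R x))) - P m (T (s + h) (R x)) with hv
  have hGv : G (m, h) (T s x) = J m ((h : ℂ)⁻¹ • v) := by
    rw [hv, add_comm s h, hT.1.2.1 h s hh.le hs.1, mul_apply_eq_comp, hT.apply_resolvent hR hs.1]
    rfl
  have hle := (norm_le_mul_norm_of_leftInverse hPJ hPnorm m ((h : ℂ)⁻¹ • v)).trans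
    (mul_le_mul_of_nonneg_left (hGv ▸ hb) hK.le)
  rwa [norm_smul, norm_inv, Complex.norm_real, Real.norm_of_nonneg hh.le, mul_div_cancel₀ _ hK.ne',
    inv_mul_le_iff₀ hh, mul_comm] at hle

/-- **Convergence of spatial-temporal discretization without splitting.**
Under the assumptions of the Key Lemma, if `A` generates a strongly continuous semigroup
`T` and the stability bound `‖[r(h A m)]^k‖ ≤ M₁ e^{kωh}` holds, then
`J m [r((t/n) A m)]^n P m x → T(t) x` as `m, n → ∞`, uniformly for `t` in compact
intervals of `[0, ∞)`. -/
theorem convergence_no_splitting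
    (X : Type*) [NormedAddCommGroup X] [NormedSpace ℂ X] [CompleteSpace X]
    (Xm : ℕ → Type*) [∀ m, NormedAddCommGroup (Xm m)] [∀ m, NormedSpace ℂ (Xm m)]
    [∀ m, CompleteSpace (Xm m)]
    -- the approximation scheme
    (P : ∀ m, X →L[ℂ] Xm m) (J : ∀ m, Xm m →L[ℂ] X)
    (hPJ : ∀ m (y : Xm m), P m (J m y) = y)
    (hJP : ∀ x : X, Tendsto (fun m => J m (P m x)) atTop (𝓝 x))
    (K : ℝ) (hK : 0 < K) (hJnorm : ∀ m, ‖J m‖ ≤ K) (hPnorm : ∀ m, ‖P m‖ ≤ K)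
    -- the operators: closed and densely defined
    (A : X →ₗ.[ℂ] X) (hAclosed : IsClosed (A.graph : Set (X × X)))
    (hAdense : Dense (A.domain : Set X))
    (Am : ∀ m, Xm m →ₗ.[ℂ] Xm m)
    (hAmclosed : ∀ m, IsClosed ((Am m).graph : Set (Xm m × Xm m)))
    (hAmdense : ∀ m, Dense ((Am m).domain : Set (Xm m)))
    -- stability of the approximating family
    (RA : ℂ → X →L[ℂ] X) (RAm : ∀ m, ℂ → Xm m →L[ℂ] Xm m) (M : ℝ) (hM : 0 ≤ M)
    (hRA : ∀ lam : ℂ, 0 < lam.re → IsResolvent A lam (RA lam) ∧ lam.re * ‖RA lam‖ ≤ M)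
    (hRAm : ∀ m, ∀ lam : ℂ, 0 < lam.re →
      IsResolvent (Am m) lam (RAm m lam) ∧ lam.re * ‖RAm m lam‖ ≤ M)
    -- consistency
    (hPdom : ∀ m, ∀ x ∈ A.domain, P m x ∈ (Am m).domain)
    (hcons : ∀ x : A.domain,
      Tendsto (fun m => J m ((Am m) ⟨P m (x : X), hPdom m x x.2⟩)) atTop (𝓝 (A x)))
    -- `A` generates the strongly continuous semigroup `T`
    (T : ℝ → X →L[ℂ] X) (hT : IsGenerator A T)
    -- the rational function, given through its partial fraction decomposition
    (l : ℕ) (ν : Fin l → ℕ) (hν : ∀ i, 1 ≤ ν i) (lam : Fin l → ℂ) (C : Fin l → ℕ → ℂ)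
    (hlam : ∀ i, 0 < (lam i).re)
    (hr0 : pfdFun l ν lam C 0 = 1)
    (hr1 : HasDerivAt (pfdFun l ν lam C) 1 0)
    (hbdd : ∃ Cb : ℝ, ∀ z : ℂ, z.re ≤ 0 → ‖pfdFun l ν lam C z‖ ≤ Cb)
    -- the stability bound for the temporal discretization
    (M₁ : ℝ) (hM₁ : 1 ≤ M₁) (ω : ℝ)
    (hstab : ∀ h : ℝ, 0 < h → ∀ k m : ℕ,
      ‖(ratOp l ν lam C (RAm m) h) ^ k‖ ≤ M₁ * Real.exp (k * ω * h)) :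
    ∀ x : X, ∀ t₀ : ℝ, 0 ≤ t₀ → ∀ ε > (0 : ℝ), ∃ N : ℕ, ∀ m ≥ N, ∀ n ≥ N,
      ∀ t : ℝ, 0 ≤ t → t ≤ t₀ →
        ‖J m (((ratOp l ν lam C (RAm m) (t / n)) ^ n) (P m x)) - T t x‖ ≤ ε := by
  intro x t₀ ht₀ ε hε
  have hR := (hRA 1 (by simp)).1
  obtain ⟨BT, hBT⟩ := hT.1.exists_norm_le t₀
  set B := M₁ * Real.exp (|ω| * t₀) with hBdef
  have hB0 : 0 < B := by positivity
  have hBT0 : 0 ≤ BT := (norm_nonneg _).trans (hBT 0 ⟨le_rfl, ht₀⟩)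
  have hpow : ∀ m n k : ℕ, 0 < n → k ≤ n → ∀ t : ℝ, 0 < t → t ≤ t₀ →
      ‖(ratOp l ν lam C (RAm m) (t / n)) ^ k‖ ≤ B := by
    intro m n k hn hk t ht htt
    have hn' : (0 : ℝ) < n := by exact_mod_cast hn
    have hk' : (k : ℝ) ≤ n := by exact_mod_cast hk
    refine (hstab (t / n) (by positivity) k m).trans ?_
    have hkt : (k : ℝ) * (t / n) ≤ t₀ := by
      calc (k : ℝ) * (t / n) ≤ n * (t / n) := by gcongr
        _ = t := by field_simp
        _ ≤ t₀ := htt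
    have hexp : k * ω * (t / n) ≤ |ω| * t₀ := by
      calc k * ω * (t / n) = ω * (k * (t / n)) := by ring
        _ ≤ |ω| * (k * (t / n)) := by
          gcongr
          exact le_abs_self ω
        _ ≤ |ω| * t₀ := by gcongr
    rw [hBdef]
    gcongr
  obtain ⟨y, hyx, hyA⟩ := Metric.dense_iff.mp hAdense x (ε / 3 / (K * B * K + BT + 1))
    (by positivity)
  rw [Metric.mem_ball, dist_eq_norm, norm_sub_rev, lt_div_iff₀ (by positivity)] at hyx
  obtain ⟨z, rfl⟩ : ∃ z, RA 1 z = y := ⟨_, hR.eq_left ⟨y, hyA⟩⟩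
  obtain ⟨N₁, δ, hδ, hstep⟩ := exists_norm_ratOp_sub_semigroup_le hK hPJ hJnorm hPnorm hJP hAdense
    hRAm hPdom hcons hlam hr0 hr1 hT hR z t₀ (ε := ε / 3 / (K * B * (t₀ + 1))) (by positivity)
  have hS : IsCompact ((fun t => T t (RA 1 z)) '' Set.Icc 0 t₀) :=
    isCompact_Icc.image_of_continuousOn ((hT.1.2.2 _).mono Set.Icc_subset_Ici_self)
  have hproj : ∀ w, Tendsto (fun m => ((J m).comp (P m) - 1) w) atTop (𝓝 0) := fun w => by
    simpa using (hJP w).sub_const w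
  obtain ⟨N₂, hN₂⟩ := eventually_atTop.mp
    (eventually_forall_mem_norm_le_of_isCompact hproj hS (show 0 < ε / 3 by positivity))
  obtain ⟨N₃, hN₃⟩ := exists_nat_gt (t₀ / δ)
  obtain ⟨N₄, hN₄⟩ := eventually_atTop.mp ((hJP x).eventually (Metric.closedBall_mem_nhds x hε))
  refine ⟨N₁ + N₂ + N₃ + N₄ + 1, fun m hm n hn t ht htt => ?_⟩
  rcases ht.eq_or_lt with rfl | htpos
  · have h1 := hN₄ m (by omega)
    rw [dist_eq_norm] at h1
    simpa [ratOp, hT.1.1] using h1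
  have hn0 : 0 < n := by omega
  have hn' : (0 : ℝ) < n := by exact_mod_cast hn0
  have hnt : (n : ℝ) * (t / n) = t := by field_simp
  have hh : 0 < t / n := by positivity
  have hhδ : t / n < δ := by
    have h3 : (N₃ : ℝ) ≤ n := by exact_mod_cast (by omega : N₃ ≤ n)
    rw [div_lt_iff₀ hδ] at hN₃
    rw [div_lt_iff₀ hn']
    nlinarith
  set F := ratOp l ν lam C (RAm m) (t / n) with hF
  have hlax : ‖(F ^ n) (P m (RA 1 z)) - P m (T t (RA 1 z))‖ ≤ ε / 3 / K := by
    have h1 := norm_pow_apply_sub_le_of_step F (P m) (n := n) (B := B)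
      (δ := ε / 3 / (K * B * (t₀ + 1)) * (t / n))
      (fun k hk => hpow m n k hn0 hk.le t htpos htt)
      (fun k : ℕ => T (k * (t / n)) (RA 1 z)) (fun k hk => by
        have hk' : (k : ℝ) ≤ n := by exact_mod_cast hk.le
        have hkt : (k : ℝ) * (t / n) ≤ t₀ := by
          calc (k : ℝ) * (t / n) ≤ n * (t / n) := by gcongr
            _ ≤ t₀ := hnt.trans_le htt
        have h2 := hstep m (by omega) (t / n) hh hhδ (k * (t / n)) ⟨by positivity, hkt⟩
        have h3 : ((k + 1 : ℕ) : ℝ) * (t / n) = k * (t / n) + t / n := by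
          push_cast
          ring
        rw [h3]
        exact h2)
    simp only [Nat.cast_zero, zero_mul, hT.1.1, one_apply_eq_self, hnt] at h1
    refine h1.trans ?_
    calc n * (B * (ε / 3 / (K * B * (t₀ + 1)) * (t / n)))
        = ε / 3 / K * (t / (t₀ + 1)) := by field_simp
      _ ≤ ε / 3 / K * 1 := by
          gcongr
          rw [div_le_one (by positivity)]
          linarith
      _ = ε / 3 / K := mul_one _
  have hJlax : ‖J m ((F ^ n) (P m (RA 1 z)) - P m (T t (RA 1 z)))‖ ≤ ε / 3 :=
    (ContinuousLinearMap.le_of_opNorm_le_of_le _ (hJnorm m) hlax).trans_eq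
      (mul_div_cancel₀ _ hK.ne')
  have hJP' : ‖J m (P m (T t (RA 1 z))) - T t (RA 1 z)‖ ≤ ε / 3 :=
    hN₂ m (by omega) _ ⟨t, ⟨ht, htt⟩, rfl⟩
  set d := x - RA 1 z with hd
  have hd1 : ‖J m ((F ^ n) (P m d))‖ ≤ K * (B * (K * ‖d‖)) :=
    ContinuousLinearMap.le_of_opNorm_le_of_le _ (hJnorm m)
      (ContinuousLinearMap.le_of_opNorm_le_of_le _ (hpow m n n hn0 le_rfl t htpos htt)
        ((P m).le_of_opNorm_le (hPnorm m) _))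
  have hd2 : ‖T t d‖ ≤ BT * ‖d‖ := (T t).le_of_opNorm_le (hBT t ⟨ht, htt⟩) _
  have hsplit : J m ((F ^ n) (P m x)) - T t x = (J m ((F ^ n) (P m d)) - T t d) +
      (J m ((F ^ n) (P m (RA 1 z)) - P m (T t (RA 1 z))) +
        (J m (P m (T t (RA 1 z))) - T t (RA 1 z))) := by
    simp only [hd, map_sub]
    abel
  rw [hsplit]
  have h1 := norm_add_le (J m ((F ^ n) (P m d)) - T t d)
    (J m ((F ^ n) (P m (RA 1 z)) - P m (T t (RA 1 z))) +
        (J m (P m (T t (RA 1 z))) - T t (RA 1 z)))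
  have h2 := norm_add_le (J m ((F ^ n) (P m (RA 1 z)) - P m (T t (RA 1 z))))
    (J m (P m (T t (RA 1 z))) - T t (RA 1 z))
  have h3 := norm_sub_le (J m ((F ^ n) (P m d))) (T t d)
  have h4 := norm_nonneg d
  linarith
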